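/- Let (X, d) be a metric space, let p, q ∈ X, let a ≤ b be real numbers, let τ ≥ 0, and let S ⊆ X be a set such that a ≤ d(p, x) ≤ b for all x ∈ S. If d(q, p) ≤ a − τ or d(q, p) ≥ b + τ, then d(q, x) ≥ τ for every x ∈ S; in particular, any point y with d(q, y) < τ does not belong to S. -/

import Mathlib

/-- Pruning guarantee of the Vantage Point tree / NearestInRange search: if all
points of a subtree `S` lie at distance between `a` and `b` from the vantage
point `p`, and the query `q` satisfies `d(q,p) ≤ a - τ` or `d(q,p) ≥ b + τ`,
then every point of `S` is at distance at least `τ` from `q`; in particular any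
point strictly within distance `τ` of `q` is not in `S`. -/
theorem vp_tree_pruning {X : Type*} [MetricSpace X] (p q : X) (a b τ : ℝ)
    (hab : a ≤ b) (hτ : 0 ≤ τ) (S : Set X)
    (hS : ∀ x ∈ S, a ≤ dist p x ∧ dist p x ≤ b)
    (h : dist q p ≤ a - τ ∨ dist q p ≥ b + τ) :
    (∀ x ∈ S, dist q x ≥ τ) ∧ ∀ y, dist q y < τ → y ∉ S := by
  have hfar : ∀ x ∈ S, dist q x ≥ τ := by
    intro x hx
    obtain ⟨ha, hb⟩ := hS x hx
    rcases h with h | h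
    · linarith [dist_triangle_left p x q]
    · linarith [dist_triangle_right q p x]
  exact ⟨hfar, fun y hy hyS => (hfar y hyS).not_gt hy⟩
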